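/- arXiv:2004.01677 — 2 statements merged into one kernel-verified Lean document; each statement's English description precedes it below -/
import Mathlib

section
/- Let f be an n-gon center function and let (V₁,…,Vₙ) be an n-gon whose cyclic values have nonzero sum, so that the geometric center P_f(V) is defined. Let S : ℝ² → ℝ² be a similarity of the plane, i.e. the composition of an isometry with a homothety x ↦ λx for some λ > 0. Then the cyclic values of (S(V₁),…,S(Vₙ)) also have nonzero sum and P_f(S(V₁),…,S(Vₙ)) = S(P_f(V₁,…,Vₙ)). -/
noncomputable section

/-- The Euclidean plane ℝ². -/
abbrev Plane : Type := EuclideanSpace ℝ (Fin 2)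

/-- The cyclic values of `f` at the `n`-gon `V`:
`cᵢ(V) = f(Vᵢ, V_{i+1}, …, V_{i+n−1})` (indices mod `n`, encoded via `ZMod n`,
labels being `1, 2, …, n` so that the `j`-th argument of `cᵢ` is `V (i + j - 1)`). -/
def cyclicValue (n : ℕ) (f : (ZMod n → Plane) → ℝ) (V : ZMod n → Plane) (i : ZMod n) : ℝ :=
  f (fun j => V (i + j - 1))

/-- An `n`-gon center function: (1) σ-symmetry for the relabelling `σ(i) = 2 + n − i (mod n)`
(note `σ(1) = 1`, so `f(V₁, V_{σ(2)}, …, V_{σ(n)}) = f(V ∘ σ)`); (2) homogeneity of some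
degree `k` under scalings by `t ≥ 0`; (3) invariance under every isometry of the plane. -/
def IsCenterFunction (n : ℕ) (f : (ZMod n → Plane) → ℝ) : Prop :=
  (∀ V : ZMod n → Plane, f (fun i => V (2 - i)) = f V) ∧
  (∃ k : ℕ, ∀ t : ℝ, 0 ≤ t → ∀ V : ZMod n → Plane, f (fun i => t • V i) = t ^ k * f V) ∧
  (∀ T : Plane → Plane, Isometry T → ∀ V : ZMod n → Plane, f (fun i => T (V i)) = f V)

/-- The sum `s(V) = c₁(V) + … + cₙ(V)` of the cyclic values. -/
def cyclicSum (n : ℕ) [NeZero n] (f : (ZMod n → Plane) → ℝ) (V : ZMod n → Plane) : ℝ :=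
  ∑ i : ZMod n, cyclicValue n f V i

/-- The geometric center `P_f(V) = Σᵢ (cᵢ(V)/s(V)) • Vᵢ` associated to `f`
(defined when `s(V) ≠ 0`). -/
def geomCenter (n : ℕ) [NeZero n] (f : (ZMod n → Plane) → ℝ) (V : ZMod n → Plane) : Plane :=
  ∑ i : ZMod n, (cyclicValue n f V i / cyclicSum n f V) • V i

theorem cyclicValue_isometry_smul {n : ℕ} {f : (ZMod n → Plane) → ℝ} {k : ℕ}
    (hk : ∀ t : ℝ, 0 ≤ t → ∀ V : ZMod n → Plane, f (fun i => t • V i) = t ^ k * f V)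
    (hi : ∀ T : Plane → Plane, Isometry T → ∀ V : ZMod n → Plane, f (fun i => T (V i)) = f V)
    {T : Plane → Plane} (hT : Isometry T) {lam : ℝ} (hlam : 0 ≤ lam)
    (V : ZMod n → Plane) (i : ZMod n) :
    cyclicValue n f (fun j => T (lam • V j)) i = lam ^ k * cyclicValue n f V i :=
  (hi T hT _).trans (hk lam hlam _)

/-- An isometry of the plane, not assumed to be surjective, is affine, so it commutes with
affine combinations. -/
theorem Isometry.map_sum_smul {ι : Type*} [Fintype ι] {T : Plane → Plane} (hT : Isometry T)
    (w : ι → ℝ) (hw : ∑ i, w i = 1) (x : ι → Plane) :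
    T (∑ i, w i • x i) = ∑ i, w i • T (x i) := by
  let A := hT.affineIsometryOfStrictConvexSpace
  have hA : ∀ y, T y = A.linearIsometry y + T 0 := fun y => by
    simpa [A] using A.map_vadd 0 y
  rw [hA, map_sum, Finset.sum_congr rfl fun i _ => congrArg (w i • ·) (hA (x i))]
  simp only [smul_add, Finset.sum_add_distrib, map_smul, ← Finset.sum_smul, hw, one_smul]

/-- if the cyclic values of `V` have nonzero sum and `S` is a similarity of the
plane (an isometry composed with a homothety `x ↦ λ•x`, `λ > 0`), then the cyclic values of
`(S(V₁),…,S(Vₙ))` also have nonzero sum and `P_f(S(V₁),…,S(Vₙ)) = S(P_f(V₁,…,Vₙ))`. -/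
theorem statement1 (n : ℕ) [NeZero n] (hn : 3 ≤ n)
    (f : (ZMod n → Plane) → ℝ) (hf : IsCenterFunction n f)
    (V : ZMod n → Plane) (hs : cyclicSum n f V ≠ 0)
    (S : Plane → Plane)
    (hS : ∃ (T : Plane → Plane) (lam : ℝ), Isometry T ∧ 0 < lam ∧
      S = fun x => T (lam • x)) :
    cyclicSum n f (fun i => S (V i)) ≠ 0 ∧
      geomCenter n f (fun i => S (V i)) = S (geomCenter n f V) := by
  obtain ⟨-, ⟨k, hk⟩, hi⟩ := hf
  obtain ⟨T, lam, hT, hlam, rfl⟩ := hS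
  have hc := cyclicValue_isometry_smul hk hi hT hlam.le V
  have hpow : lam ^ k ≠ 0 := pow_ne_zero k hlam.ne'
  have hsum : cyclicSum n f (fun i => T (lam • V i)) = lam ^ k * cyclicSum n f V := by
    simp only [cyclicSum, hc, Finset.mul_sum]
  refine ⟨hsum ▸ mul_ne_zero hpow hs, ?_⟩
  have hw : ∑ i, cyclicValue n f V i / cyclicSum n f V = 1 := by
    rw [← Finset.sum_div]
    exact div_self hs
  simp only [geomCenter, hsum, hc, mul_div_mul_left _ _ hpow, Finset.smul_sum, smul_comm lam]
  exact (hT.map_sum_smul _ hw _).symm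
end
end

section
/- Let f be an n-gon center function, let (V₁,…,Vₙ) be an n-gon whose cyclic values have nonzero sum, and let α be any element of the dihedral group Dₙ viewed as a permutation of the indices {1,…,n}. Then the cyclic values of the relabelled n-gon (V_{α(1)},…,V_{α(n)}) also have nonzero sum and the geometric center is unchanged: P_f(V_{α(1)},…,V_{α(n)}) = P_f(V₁,…,Vₙ). -/
noncomputable section

/-- The rotation `ρ(i) = i + 1 (mod n)` as a permutation of the index set. -/
def rotPerm (n : ℕ) : Equiv.Perm (ZMod n) := Equiv.addRight (1 : ZMod n)

/-- The reflection `σ(i) = 2 + n − i (mod n)` as a permutation of the index set. -/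
def refPerm (n : ℕ) : Equiv.Perm (ZMod n) :=
  (Equiv.neg (ZMod n)).trans (Equiv.addLeft (2 : ZMod n))

/-- The dihedral group `Dₙ`, viewed as the subgroup of permutations of the index set
generated by `ρ` and `σ`. -/
def dihedral (n : ℕ) : Subgroup (Equiv.Perm (ZMod n)) :=
  Subgroup.closure {rotPerm n, refPerm n}

/-- Relabelling a polygon by a dihedral permutation permutes its cyclic values accordingly. -/
theorem cyclicValue_comp_of_mem_dihedral {n : ℕ} {f : (ZMod n → Plane) → ℝ}
    (hf : ∀ V : ZMod n → Plane, f (fun i => V (2 - i)) = f V)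
    {α : Equiv.Perm (ZMod n)} (hα : α ∈ dihedral n) (V : ZMod n → Plane) (i : ZMod n) :
    cyclicValue n f (fun j => V (α j)) i = cyclicValue n f V (α i) := by
  induction hα using Subgroup.closure_induction generalizing V i with
  | mem α h =>
    rcases h with rfl | rfl
    · simp only [cyclicValue, rotPerm, Equiv.coe_addRight]
      congr! 3
      ring
    · simp only [cyclicValue, refPerm, Equiv.trans_apply, Equiv.neg_apply, Equiv.coe_addLeft]
      rw [← hf (fun j => V (2 + -i + j - 1))]
      congr! 3
      ring
  | one => rfl
  | mul α β _ _ hα hβ => exact (hβ (fun j => V (α j)) i).trans (hα V (β i))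
  | inv α _ hα => simpa using (hα (fun j => V (α⁻¹ j)) (α⁻¹ i)).symm

/-- if the cyclic values of `V` have nonzero sum and `α ∈ Dₙ`, then the cyclic
values of the relabelled `n`-gon `(V_{α(1)},…,V_{α(n)})` also have nonzero sum and the
geometric center is unchanged: `P_f(V_{α(1)},…,V_{α(n)}) = P_f(V₁,…,Vₙ)`. -/
theorem statement2 (n : ℕ) [NeZero n] (hn : 3 ≤ n)
    (f : (ZMod n → Plane) → ℝ) (hf : IsCenterFunction n f)
    (V : ZMod n → Plane) (hs : cyclicSum n f V ≠ 0)
    (α : Equiv.Perm (ZMod n)) (hα : α ∈ dihedral n) :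
    cyclicSum n f (fun i => V (α i)) ≠ 0 ∧
      geomCenter n f (fun i => V (α i)) = geomCenter n f V := by
  have hc := cyclicValue_comp_of_mem_dihedral hf.1 hα V
  have hsum : cyclicSum n f (fun i => V (α i)) = cyclicSum n f V := by
    simp only [cyclicSum, hc]
    exact Equiv.sum_comp α (cyclicValue n f V)
  refine ⟨hsum ▸ hs, ?_⟩
  simp only [geomCenter, hsum, hc]
  exact Equiv.sum_comp α (fun i => (cyclicValue n f V i / cyclicSum n f V) • V i)
end
end
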